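/- Let B be a real Banach space, V a nonempty weakly compact convex subset of B having normal structure, (Ω, 𝓕, P) a probability space, and 𝒯 a family of strong random operators from Ω × V to V such that for each T ∈ 𝒯 and each ω ∈ Ω the map T(ω,·) : V → V is a surjective isometry. Then there exists a strong random element x⁰ : Ω → B with x⁰(ω) ∈ c(V,V) (the Chebyshev center of V) for all ω ∈ Ω such that for each T ∈ 𝒯, T(ω, x⁰(ω)) = x⁰(ω) for almost all ω ∈ Ω. -/

import Mathlib

open MeasureTheory Set Filter Function
open scoped Classical

noncomputable section

namespace RNM


variable {B : Type*} [NormedAddCommGroup B] [NormedSpace ℝ B]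

/-- `sup_{y ∈ K} ‖x − y‖`. -/
def supDist (K : Set B) (x : B) : ℝ := ⨆ y : K, ‖x - (y : B)‖

/-- The Chebyshev radius `r(K,K)` of `K`. -/
def chebRadius (K : Set B) : ℝ := ⨅ z : K, supDist K (z : B)

/-- The Chebyshev center `c(K,K)` of `K`. -/
def chebCenter (K : Set B) : Set B := {x ∈ K | supDist K x = chebRadius K}

/-- `K` has normal structure: every closed convex subset of `K` containing more than one
point has a nondiametral point. -/
def NormalStructure (K : Set B) : Prop :=
  ∀ F, F ⊆ K → IsClosed F → Convex ℝ F → F.Nontrivial →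
    ∃ x ∈ F, supDist F x < Metric.diam F

/-- `K` is compact in the weak topology of `B`. -/
def WeaklyCompact (K : Set B) : Prop := IsCompact (toWeakSpace ℝ B '' K)


lemma weak_nonempty_sInter {V : Set B} (hVwc : WeaklyCompact V) (c : Set (Set B))
    (hne : c.Nonempty) (hdir : DirectedOn (· ⊇ ·) c)
    (hc : ∀ K ∈ c, K ⊆ V ∧ IsClosed K ∧ Convex ℝ K ∧ K.Nonempty) : (⋂₀ c).Nonempty := by
  have hcl : ∀ K ∈ c, IsClosed (toWeakSpace ℝ B '' K) := by
    intro K hK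
    obtain ⟨h1, h2, h3, h4⟩ := hc K hK
    have := h3.toWeakSpace_closure ℝ
    rw [h2.closure_eq] at this
    rw [this]
    exact isClosed_closure
  have : Nonempty c := hne.to_subtype
  have key := IsCompact.nonempty_iInter_of_directed_nonempty_isCompact_isClosed
    (fun K : c => toWeakSpace ℝ B '' (K : Set B)) ?_ ?_ ?_ ?_
  · obtain ⟨y, hy⟩ := key
    rw [mem_iInter] at hy
    refine ⟨(toWeakSpace ℝ B).symm y, ?_⟩
    intro K hK
    obtain ⟨x, hx, hxy⟩ := hy ⟨K, hK⟩
    rw [← hxy]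
    simpa using hx
  · intro K L
    obtain ⟨M, hM, h1, h2⟩ := hdir K K.2 L L.2
    exact ⟨⟨M, hM⟩, image_mono h1, image_mono h2⟩
  · intro K
    exact (hc K K.2).2.2.2.image _
  · intro K
    exact hVwc.of_isClosed_subset (hcl K K.2) (image_mono (hc K K.2).1)
  · intro K
    exact hcl K K.2

lemma weak_isClosed {V : Set B} (hVwc : WeaklyCompact V) : IsClosed V := by
  have h : IsClosed (toWeakSpace ℝ B '' V) := IsCompact.isClosed hVwc
  have h2 := h.preimage (toWeakSpaceCLM ℝ B).continuous
  convert h2 using 1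
  ext x
  constructor
  · intro hx
    exact ⟨x, hx, rfl⟩
  · rintro ⟨y, hy, hyx⟩
    have : y = x := (toWeakSpace ℝ B).injective hyx
    exact this ▸ hy

lemma weak_bounded {V : Set B} (hVwc : WeaklyCompact V) : ∃ C, ∀ x ∈ V, ‖x‖ ≤ C := by
  have := banach_steinhaus
    (g := fun x : V => NormedSpace.inclusionInDoubleDual ℝ B (x : B)) ?_
  · obtain ⟨C, hC⟩ := this
    refine ⟨C, fun x hx => ?_⟩
    have := hC ⟨x, hx⟩
    have h2 := (NormedSpace.inclusionInDoubleDualLi (E := B) ℝ).norm_map x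
    rw [← h2]
    exact this
  · intro f
    have hf : Continuous (fun y : WeakSpace ℝ B => f ((toWeakSpace ℝ B).symm y)) :=
      WeakBilin.eval_continuous (topDualPairing ℝ B).flip f
    obtain ⟨C, hC⟩ := IsCompact.exists_bound_of_continuousOn hVwc hf.continuousOn
    refine ⟨C, fun x => ?_⟩
    have := hC _ ⟨x, x.2, rfl⟩
    simpa using this

lemma le_supDist {K : Set B} {C : ℝ} (hC : ∀ x ∈ K, ‖x‖ ≤ C) (x : B) {y : B} (hy : y ∈ K) :
    ‖x - y‖ ≤ supDist K x := by
  have : BddAbove (range fun y : K => ‖x - (y : B)‖) := by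
    refine ⟨‖x‖ + C, ?_⟩
    rintro _ ⟨y, rfl⟩
    exact (norm_sub_le _ _).trans (by have := hC y y.2; linarith)
  exact le_ciSup this ⟨y, hy⟩

lemma supDist_le {K : Set B} (hK : K.Nonempty) {x : B} {r : ℝ} (h : ∀ y ∈ K, ‖x - y‖ ≤ r) :
    supDist K x ≤ r := by
  have := hK.to_subtype
  exact ciSup_le fun y => h y y.2

lemma supDist_nonneg (K : Set B) (x : B) : 0 ≤ supDist K x :=
  Real.iSup_nonneg fun _ => norm_nonneg _

lemma chebRadius_le {K : Set B} {x : B} (hx : x ∈ K) : chebRadius K ≤ supDist K x := by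
  have : BddBelow (range fun z : K => supDist K (z : B)) := by
    refine ⟨0, ?_⟩
    rintro _ ⟨y, rfl⟩
    exact supDist_nonneg _ _
  exact ciInf_le this ⟨x, hx⟩

/-- Points of `K` whose closed ball of radius `r` contains `K`. -/
def nearSet (K : Set B) (r : ℝ) : Set B := K ∩ ⋂ y ∈ K, Metric.closedBall y r

lemma mem_nearSet {K : Set B} {r : ℝ} {x : B} :
    x ∈ nearSet K r ↔ x ∈ K ∧ ∀ y ∈ K, ‖x - y‖ ≤ r := by
  simp [nearSet, dist_eq_norm]

lemma nearSet_closed {K : Set B} (hK : IsClosed K) (r : ℝ) : IsClosed (nearSet K r) :=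
  hK.inter (isClosed_biInter fun _ _ => Metric.isClosed_closedBall)

lemma nearSet_convex {K : Set B} (hK : Convex ℝ K) (r : ℝ) : Convex ℝ (nearSet K r) :=
  hK.inter (convex_iInter₂ fun _ _ => convex_closedBall _ _)

lemma chebCenter_eq {K : Set B} {C : ℝ} (hC : ∀ x ∈ K, ‖x‖ ≤ C) :
    chebCenter K = nearSet K (chebRadius K) := by
  ext x
  rw [mem_nearSet]
  constructor
  · rintro ⟨h1, h2⟩
    exact ⟨h1, fun y hy => h2 ▸ le_supDist hC x hy⟩
  · rintro ⟨h1, h2⟩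
    exact ⟨h1, le_antisymm (supDist_le ⟨x, h1⟩ h2) (chebRadius_le h1)⟩

lemma chebCenter_nonempty {V K : Set B} (hVwc : WeaklyCompact V) (hKV : K ⊆ V)
    (hKc : IsClosed K) (hKx : Convex ℝ K) (hK : K.Nonempty) : (chebCenter K).Nonempty := by
  obtain ⟨C, hC⟩ := weak_bounded hVwc
  have hC' : ∀ x ∈ K, ‖x‖ ≤ C := fun x hx => hC x (hKV hx)
  have hmono : ∀ r s, r ≤ s → nearSet K r ⊆ nearSet K s := by
    intro r s hrs x hx
    rw [mem_nearSet] at hx ⊢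
    exact ⟨hx.1, fun y hy => (hx.2 y hy).trans hrs⟩
  have := weak_nonempty_sInter hVwc (nearSet K '' Ioi (chebRadius K))
    (nonempty_Ioi.image _) ?_ ?_
  · obtain ⟨x, hx⟩ := this
    have hx' : ∀ r, chebRadius K < r → x ∈ nearSet K r := fun r hr => hx _ ⟨r, hr, rfl⟩
    refine ⟨x, ?_⟩
    rw [chebCenter_eq hC', mem_nearSet]
    refine ⟨(mem_nearSet.1 (hx' _ (lt_add_one _))).1, fun y hy => ?_⟩
    exact le_of_forall_gt_imp_ge_of_dense fun r hr => (mem_nearSet.1 (hx' r hr)).2 y hy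
  · rintro _ ⟨r, hr, rfl⟩ _ ⟨s, hs, rfl⟩
    exact ⟨_, ⟨min r s, mem_Ioi.2 (lt_min (mem_Ioi.1 hr) (mem_Ioi.1 hs)), rfl⟩, hmono _ _ (min_le_left _ _),
      hmono _ _ (min_le_right _ _)⟩
  · rintro _ ⟨r, hr, rfl⟩
    refine ⟨fun x hx => hKV hx.1, nearSet_closed hKc r, nearSet_convex hKx r, ?_⟩
    have := hK.to_subtype
    obtain ⟨z, hz⟩ := exists_lt_of_ciInf_lt (show (⨅ z : K, supDist K (z : B)) < r from hr)
    exact ⟨z, mem_nearSet.2 ⟨z.2, fun y hy => (le_supDist hC' _ hy).trans hz.le⟩⟩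

lemma supDist_image {K : Set B} {S : B → B} (hS : S '' K = K)
    (hiso : ∀ x ∈ K, ∀ y ∈ K, ‖S x - S y‖ = ‖x - y‖) {C : ℝ} (hC : ∀ x ∈ K, ‖x‖ ≤ C)
    {x : B} (hx : x ∈ K) : supDist K (S x) = supDist K x := by
  apply le_antisymm
  · refine supDist_le ⟨x, hx⟩ fun y hy => ?_
    rw [← hS] at hy
    obtain ⟨z, hz, rfl⟩ := hy
    rw [hiso x hx z hz]
    exact le_supDist hC x hz
  · refine supDist_le ⟨x, hx⟩ fun y hy => ?_
    rw [← hiso x hx y hy]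
    exact le_supDist hC _ (hS ▸ mem_image_of_mem S hy)

lemma chebCenter_image {K : Set B} {S : B → B} (hS : S '' K = K)
    (hiso : ∀ x ∈ K, ∀ y ∈ K, ‖S x - S y‖ = ‖x - y‖) {C : ℝ} (hC : ∀ x ∈ K, ‖x‖ ≤ C) :
    S '' chebCenter K = chebCenter K := by
  ext z
  constructor
  · rintro ⟨x, ⟨h1, h2⟩, rfl⟩
    exact ⟨hS ▸ mem_image_of_mem S h1, (supDist_image hS hiso hC h1).trans h2⟩
  · rintro ⟨h1, h2⟩
    rw [← hS] at h1
    obtain ⟨x, hx, rfl⟩ := h1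
    exact ⟨x, ⟨hx, (supDist_image hS hiso hC hx).symm.trans h2⟩, rfl⟩

/-- Brodskii-Milman: a point of the Chebyshev center fixed by all surjective isometries. -/
lemma brodskii_milman [CompleteSpace B] {V : Set B} (hVne : V.Nonempty) (hVconv : Convex ℝ V)
    (hVwc : WeaklyCompact V) (hVns : NormalStructure V) :
    ∃ p ∈ chebCenter V, ∀ S : B → B, S '' V = V →
      (∀ x ∈ V, ∀ y ∈ V, ‖S x - S y‖ = ‖x - y‖) → S p = p := by
  obtain ⟨C, hC⟩ := weak_bounded hVwc
  have hVcl := weak_isClosed hVwc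
  let 𝒢 : Set (B → B) := {S | S '' V = V ∧ ∀ x ∈ V, ∀ y ∈ V, ‖S x - S y‖ = ‖x - y‖}
  let 𝒦 : Set (Set B) := {K | K ⊆ V ∧ IsClosed K ∧ Convex ℝ K ∧ K.Nonempty ∧
    ∀ S ∈ 𝒢, S '' K = K}
  have hcheb : ∀ K ∈ 𝒦, chebCenter K ∈ 𝒦 := by
    rintro K ⟨h1, h2, h3, h4, h5⟩
    have hC' : ∀ x ∈ K, ‖x‖ ≤ C := fun x hx => hC x (h1 hx)
    refine ⟨fun x hx => h1 hx.1, ?_, ?_, chebCenter_nonempty hVwc h1 h2 h3 h4, ?_⟩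
    · rw [chebCenter_eq hC']
      exact nearSet_closed h2 _
    · rw [chebCenter_eq hC']
      exact nearSet_convex h3 _
    · intro S hS
      exact chebCenter_image (h5 S hS) (fun x hx y hy => hS.2 x (h1 hx) y (h1 hy)) hC'
  have hV : V ∈ 𝒦 := ⟨Subset.rfl, hVcl, hVconv, hVne, fun S hS => hS.1⟩
  obtain ⟨K, hKsub, hKmin⟩ := zorn_superset_nonempty 𝒦 (by
    intro c hc hchain hcne
    refine ⟨⋂₀ c, ⟨?_, ?_, ?_, ?_, ?_⟩, fun s hs => sInter_subset_of_mem hs⟩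
    · obtain ⟨K, hK⟩ := hcne
      exact (sInter_subset_of_mem hK).trans (hc hK).1
    · exact isClosed_sInter fun K hK => (hc hK).2.1
    · exact convex_sInter fun K hK => (hc hK).2.2.1
    · refine weak_nonempty_sInter hVwc c hcne ?_ fun K hK =>
        ⟨(hc hK).1, (hc hK).2.1, (hc hK).2.2.1, (hc hK).2.2.2.1⟩
      intro K hK L hL
      rcases hchain.total hK hL with h | h
      · exact ⟨K, hK, Subset.rfl, h⟩
      · exact ⟨L, hL, h, Subset.rfl⟩
    · intro S hS
      ext z
      constructor
      · rintro ⟨x, hx, rfl⟩ K hK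
        rw [← (hc hK).2.2.2.2 S hS]
        exact mem_image_of_mem S (hx K hK)
      · intro hz
        obtain ⟨K, hK⟩ := hcne
        have hzK := hz K hK
        rw [← (hc hK).2.2.2.2 S hS] at hzK
        obtain ⟨x, hx, rfl⟩ := hzK
        refine ⟨x, fun L hL => ?_, rfl⟩
        have hzL := hz L hL
        rw [← (hc hL).2.2.2.2 S hS] at hzL
        obtain ⟨y, hy, hyx⟩ := hzL
        have h := hS.2 y ((hc hL).1 hy) x ((hc hK).1 hx)
        rw [hyx, sub_self, norm_zero] at h
        have : y = x := sub_eq_zero.1 (norm_eq_zero.1 h.symm)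
        exact this ▸ hy) (chebCenter V) (hcheb V hV)
  obtain ⟨h1, h2, h3, h4, h5⟩ := hKmin.prop
  have hC' : ∀ x ∈ K, ‖x‖ ≤ C := fun x hx => hC x (h1 hx)
  have hKc : K ⊆ chebCenter K := hKmin.le_of_le (hcheb K hKmin.prop) fun x hx => hx.1
  have hsub : ¬ K.Nontrivial := by
    intro hnt
    obtain ⟨x, hx, hlt⟩ := hVns K h1 h2 h3 hnt
    have : Metric.diam K ≤ chebRadius K := by
      refine Metric.diam_le_of_forall_dist_le (Real.iInf_nonneg fun _ => supDist_nonneg _ _) ?_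
      intro a ha b hb
      rw [dist_eq_norm, ← (hKc ha).2]
      exact le_supDist hC' a hb
    have := chebRadius_le hx
    linarith
  rw [not_nontrivial_iff] at hsub
  obtain ⟨p, hp⟩ := h4
  refine ⟨p, hKsub hp, fun S hS hSi => hsub ?_ hp⟩
  have := h5 S ⟨hS, hSi⟩
  exact this ▸ mem_image_of_mem S hp

/-- A family (no commutativity assumed) of strong random surjective isometric operators
from `Ω × V` to `V`, where `V` is a nonempty weakly compact convex subset with normal
structure of a Banach space `B`, has a common random fixed point taking values in the
Chebyshev center of `V`. -/
theorem common_random_fixed_point_of_surjective_isometric_in_chebCenter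
    {B : Type*} [NormedAddCommGroup B] [NormedSpace ℝ B] [CompleteSpace B]
    (V : Set B) (hVne : V.Nonempty) (hVconv : Convex ℝ V)
    (hVwc : WeaklyCompact V) (hVns : NormalStructure V)
    {Ω : Type*} [MeasurableSpace Ω] (P : Measure Ω) [IsProbabilityMeasure P]
    (𝒯 : Set (Ω → B → B))
    (hmaps : ∀ T ∈ 𝒯, ∀ ω : Ω, Set.MapsTo (T ω) V V)
    (hsurj : ∀ T ∈ 𝒯, ∀ ω : Ω, Set.SurjOn (T ω) V V)
    (hmeas : ∀ T ∈ 𝒯, ∀ x ∈ V, AEStronglyMeasurable (fun ω => T ω x) P)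
    (hiso : ∀ T ∈ 𝒯, ∀ ω : Ω, ∀ x ∈ V, ∀ y ∈ V, ‖T ω x - T ω y‖ = ‖x - y‖) :
    ∃ x0 : Ω → B, AEStronglyMeasurable x0 P ∧ (∀ ω, x0 ω ∈ chebCenter V) ∧
      ∀ T ∈ 𝒯, ∀ᵐ ω ∂P, T ω (x0 ω) = x0 ω := by
  obtain ⟨p, hp, hfix⟩ := brodskii_milman hVne hVconv hVwc hVns
  refine ⟨fun _ => p, aestronglyMeasurable_const, fun _ => hp, fun T hT => ?_⟩
  refine Eventually.of_forall fun ω => hfix (T ω) ?_ (hiso T hT ω)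
  exact (hsurj T hT ω).image_eq_of_mapsTo (hmaps T hT ω)

end RNM
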